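/- arXiv:math/0702552 — 4 statements merged into one kernel-verified Lean document; each statement's English description precedes it below -/
import Mathlib

section
/- Let P0, P1, Q0, Q1 ∈ Ω. Assume the shift vectors are equivalent, i.e. σ(P0,Q1) + σ(P1,Q0) − σ(P0,P1) − σ(Q0,Q1) = 2√(σ(P0,Q0)·σ(P1,Q1)) and σ(P0,Q0) = σ(P1,Q1), and assume the parallelism condition σ(P0,Q1) + σ(P1,Q0) − σ(P0,Q0) − σ(P1,Q1) = 2√(σ(P0,P1)·σ(Q0,Q1)). If σ(P0,P1) ≥ 0, σ(Q0,Q1) ≥ 0 and σ(P0,Q0) ≥ 0, then σ(P0,P1) = σ(Q0,Q1), and consequently P0P1 eqv Q0Q1. -/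
/-- Let `σ` be a world function on `Ω`. If the shift vectors `P0Q0` and
`P1Q1` are equivalent and the parallelism condition for `P0P1`, `Q0Q1` holds, and if
`σ(P0,P1) ≥ 0`, `σ(Q0,Q1) ≥ 0`, `σ(P0,Q0) ≥ 0`, then `σ(P0,P1) = σ(Q0,Q1)` and
consequently `P0P1 eqv Q0Q1`. -/
theorem shift_equiv_and_parallel_implies_equiv
    {Ω : Type*} (σ : Ω → Ω → ℝ)
    (hsymm : ∀ P Q : Ω, σ P Q = σ Q P)
    (hzero : ∀ P : Ω, σ P P = 0)
    (P0 P1 Q0 Q1 : Ω)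
    (hshift_par : σ P0 Q1 + σ P1 Q0 - σ P0 P1 - σ Q0 Q1
      = 2 * Real.sqrt (σ P0 Q0 * σ P1 Q1))
    (hshift_len : σ P0 Q0 = σ P1 Q1)
    (hpar : σ P0 Q1 + σ P1 Q0 - σ P0 Q0 - σ P1 Q1
      = 2 * Real.sqrt (σ P0 P1 * σ Q0 Q1))
    (hpos1 : 0 ≤ σ P0 P1) (hpos2 : 0 ≤ σ Q0 Q1) (hpos3 : 0 ≤ σ P0 Q0) :
    σ P0 P1 = σ Q0 Q1 ∧
      (σ P0 Q1 + σ P1 Q0 - σ P0 Q0 - σ P1 Q1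
        = 2 * Real.sqrt (σ P0 P1 * σ Q0 Q1) ∧ σ P0 P1 = σ Q0 Q1) := by
  have hlen : σ P0 P1 = σ Q0 Q1 := by
    rw [← hshift_len, Real.sqrt_mul_self hpos3] at hshift_par
    have hsum : σ P0 P1 + σ Q0 Q1 = 2 * Real.sqrt (σ P0 P1 * σ Q0 Q1) := by linarith
    have hsq := Real.sq_sqrt (mul_nonneg hpos1 hpos2)
    have hdiff : (σ P0 P1 - σ Q0 Q1) ^ 2 = 0 := by
      linear_combination (σ P0 P1 + σ Q0 Q1 + 2 * Real.sqrt (σ P0 P1 * σ Q0 Q1)) * hsum + 4 * hsq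
    exact sub_eq_zero.mp (pow_eq_zero_iff two_ne_zero |>.mp hdiff)
  exact ⟨hlen, hpar, hlen⟩
end

section
/- In a real inner product space E, equivalence of vectors is single-variant and coincides with vector equality: for all P0, P1, Q0, Q1 ∈ E, P0P1 eqv Q0Q1 if and only if P1 − P0 = Q1 − Q0. -/
/-- The Euclidean world function `σ_E(P,Q) = ½‖P−Q‖²`. -/
noncomputable def sigmaE {E : Type*} [NormedAddCommGroup E] [InnerProductSpace ℝ E]
    (P Q : E) : ℝ := ‖P - Q‖ ^ 2 / 2

/-- Equivalence of vectors in a real inner product space: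
`(P0P1.Q0Q1) = |P0P1|·|Q0Q1|` and `|P0P1| = |Q0Q1|`. -/
noncomputable def eqvE {E : Type*} [NormedAddCommGroup E] [InnerProductSpace ℝ E]
    (P0 P1 Q0 Q1 : E) : Prop :=
  (sigmaE P0 Q1 + sigmaE P1 Q0 - sigmaE P0 Q0 - sigmaE P1 Q1
    = ‖P1 - P0‖ * ‖Q1 - Q0‖) ∧ ‖P1 - P0‖ = ‖Q1 - Q0‖

/-- The scalar product built from the world function is the inner product. -/
theorem sigmaE_add_sub_sub_eq_inner {E : Type*} [NormedAddCommGroup E] [InnerProductSpace ℝ E]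
    (P0 P1 Q0 Q1 : E) :
    sigmaE P0 Q1 + sigmaE P1 Q0 - sigmaE P0 Q0 - sigmaE P1 Q1
      = inner ℝ (P1 - P0) (Q1 - Q0) := by
  simp only [sigmaE, norm_sub_sq_real, inner_sub_left, inner_sub_right]
  ring

/-- In a real inner product space, equivalence of vectors is
single-variant and coincides with vector equality. -/
theorem eqvE_iff_sub_eq {E : Type*} [NormedAddCommGroup E] [InnerProductSpace ℝ E]
    (P0 P1 Q0 Q1 : E) :
    eqvE P0 P1 Q0 Q1 ↔ P1 - P0 = Q1 - Q0 := by
  rw [eqvE, sigmaE_add_sub_sub_eq_inner]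
  constructor
  · rintro ⟨h_inner, h_norm⟩
    rw [← sub_eq_zero, ← norm_eq_zero, ← sq_eq_zero_iff, norm_sub_sq_real, h_inner, h_norm]
    ring
  · intro h
    rw [h]
    exact ⟨real_inner_self_eq_norm_mul_norm _, rfl⟩
end

section
/- Equivalence of adjacent timelike vectors in the distorted space-time (Case II, P1 = Q0): let s > 0, λ0 > 0, α0, γ1, γ2, γ3 ∈ ℝ, and let P0 = (0,0,0,0), P1 = Q0 = (s,0,0,0), Q1 = (2s+α0, γ1, γ2, γ3) in ℝ⁴. Assume σ_M(X,Y) > 0 for every pair of distinct points X, Y among {P0, P1, Q1}. Then P0P1 eqv Q0Q1 (with respect to σ_d) if and only if s(s+α0) = s² + 3λ0² and s² = (s+α0)² − γ1² − γ2² − γ3², which holds if and only if α0 = 3λ0²/s and γ1² + γ2² + γ3² = 6λ0²(1 + 3λ0²/(2s²)). -/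
/-- The Minkowski bilinear form on `ℝ⁴`. -/
def eta (u v : Fin 4 → ℝ) : ℝ :=
  u 0 * v 0 - u 1 * v 1 - u 2 * v 2 - u 3 * v 3

/-- The Minkowski world function `σ_M(x,y) = ½η(x−y, x−y)`. -/
noncomputable def sigmaM (x y : Fin 4 → ℝ) : ℝ := eta (x - y) (x - y) / 2

/-- The distorted world function: `σ_d = σ_M + lam0²` on timelike-separated pairs,
`σ_d = σ_M` otherwise. -/
noncomputable def sigmaD (lam0 : ℝ) (x y : Fin 4 → ℝ) : ℝ :=
  if 0 < sigmaM x y then sigmaM x y + lam0 ^ 2 else sigmaM x y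

/-- The σ-immanent scalar product `(P0P1.Q0Q1)` with respect to `σ_d`. -/
noncomputable def sprodD (lam0 : ℝ) (P0 P1 Q0 Q1 : Fin 4 → ℝ) : ℝ :=
  sigmaD lam0 P0 Q1 + sigmaD lam0 P1 Q0 - sigmaD lam0 P0 Q0 - sigmaD lam0 P1 Q1

/-- Equivalence of vectors in the distorted space-time:
`(P0P1.Q0Q1) = |P0P1|·|Q0Q1|` (with `|P0P1| = √(2σ_d(P0,P1))`) and
`σ_d(P0,P1) = σ_d(Q0,Q1)`. -/
noncomputable def eqvD (lam0 : ℝ) (P0 P1 Q0 Q1 : Fin 4 → ℝ) : Prop :=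
  sprodD lam0 P0 P1 Q0 Q1
    = Real.sqrt (2 * sigmaD lam0 P0 P1) * Real.sqrt (2 * sigmaD lam0 Q0 Q1) ∧
  sigmaD lam0 P0 P1 = sigmaD lam0 Q0 Q1

/-- Timelike-separated points: `σ_d` is `σ_M` shifted by `lam0²`. -/
theorem sigmaD_of_pos {lam0 : ℝ} {x y : Fin 4 → ℝ} (h : 0 < sigmaM x y) :
    sigmaD lam0 x y = sigmaM x y + lam0 ^ 2 := if_pos h

theorem sigmaD_self (lam0 : ℝ) (x : Fin 4 → ℝ) : sigmaD lam0 x x = 0 := by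
  simp [sigmaD, sigmaM, eta]

theorem sigmaD_comm (lam0 : ℝ) (x y : Fin 4 → ℝ) : sigmaD lam0 x y = sigmaD lam0 y x := by
  have h : sigmaM x y = sigmaM y x := by
    simp only [sigmaM, eta, Pi.sub_apply]
    ring
  simp only [sigmaD, h]

/-- For vectors of non-negative squared length, equivalence involves no square roots. -/
theorem eqvD_iff_of_nonneg {lam0 : ℝ} {P0 P1 Q0 Q1 : Fin 4 → ℝ} (h : 0 ≤ sigmaD lam0 P0 P1) :
    eqvD lam0 P0 P1 Q0 Q1 ↔
      sprodD lam0 P0 P1 Q0 Q1 = 2 * sigmaD lam0 P0 P1 ∧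
        sigmaD lam0 P0 P1 = sigmaD lam0 Q0 Q1 := by
  unfold eqvD
  refine and_congr_left fun hlen => ?_
  rw [← hlen, Real.mul_self_sqrt (by positivity)]

/-- Equivalence of adjacent timelike vectors in the distorted
space-time (Case II, `P1 = Q0`): with `P0 = (0,0,0,0)`, `P1 = Q0 = (s,0,0,0)`,
`Q1 = (2s+α0, γ1, γ2, γ3)`, all pairs of distinct points among `{P0, P1, Q1}`
timelike-separated, `P0P1 eqv Q0Q1` iff `s(s+α0) = s² + 3lam0²` and
`s² = (s+α0)² − γ1² − γ2² − γ3²`, which holds iff `α0 = 3lam0²/s` and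
`γ1² + γ2² + γ3² = 6lam0²(1 + 3lam0²/(2s²))`. -/
theorem timelike_eqv_case_II (s lam0 α0 γ1 γ2 γ3 : ℝ)
    (hs : 0 < s) (hlam0 : 0 < lam0)
    (P0 P1 Q0 Q1 : Fin 4 → ℝ)
    (hP0 : P0 = ![0, 0, 0, 0]) (hP1 : P1 = ![s, 0, 0, 0]) (hQ0 : Q0 = ![s, 0, 0, 0])
    (hQ1 : Q1 = ![2 * s + α0, γ1, γ2, γ3])
    (htime : ∀ X ∈ ({P0, P1, Q1} : Set (Fin 4 → ℝ)),
      ∀ Y ∈ ({P0, P1, Q1} : Set (Fin 4 → ℝ)), X ≠ Y → 0 < sigmaM X Y) :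
    (eqvD lam0 P0 P1 Q0 Q1 ↔
      (s * (s + α0) = s ^ 2 + 3 * lam0 ^ 2 ∧
        s ^ 2 = (s + α0) ^ 2 - γ1 ^ 2 - γ2 ^ 2 - γ3 ^ 2)) ∧
    ((s * (s + α0) = s ^ 2 + 3 * lam0 ^ 2 ∧
        s ^ 2 = (s + α0) ^ 2 - γ1 ^ 2 - γ2 ^ 2 - γ3 ^ 2) ↔
      (α0 = 3 * lam0 ^ 2 / s ∧
        γ1 ^ 2 + γ2 ^ 2 + γ3 ^ 2 = 6 * lam0 ^ 2 * (1 + 3 * lam0 ^ 2 / (2 * s ^ 2)))) := by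
  subst hP0 hP1 hQ0 hQ1
  set P0 : Fin 4 → ℝ := ![0, 0, 0, 0] with hP0
  set P1 : Fin 4 → ℝ := ![s, 0, 0, 0] with hP1
  set Q1 : Fin 4 → ℝ := ![2 * s + α0, γ1, γ2, γ3] with hQ1
  have hM01 : sigmaM P0 P1 = s ^ 2 / 2 := by
    simp [sigmaM, eta, hP0, hP1]
    ring
  have hM1Q : sigmaM P1 Q1 = ((s + α0) ^ 2 - γ1 ^ 2 - γ2 ^ 2 - γ3 ^ 2) / 2 := by
    simp [sigmaM, eta, hP1, hQ1]
    ring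
  have hM0Q : sigmaM P0 Q1 = ((2 * s + α0) ^ 2 - γ1 ^ 2 - γ2 ^ 2 - γ3 ^ 2) / 2 := by
    simp [sigmaM, eta, hP0, hQ1]
    ring
  have hD01 : sigmaD lam0 P0 P1 = s ^ 2 / 2 + lam0 ^ 2 := by
    rw [sigmaD_of_pos (by rw [hM01]; positivity), hM01]
  have hpos : 0 < s ^ 2 / 2 + lam0 ^ 2 := by positivity
  constructor
  · rw [eqvD_iff_of_nonneg (hD01 ▸ hpos.le), sprodD, sigmaD_self, hD01]
    by_cases h1Q : P1 = Q1
    · have hs2 : (s + α0) ^ 2 - γ1 ^ 2 - γ2 ^ 2 - γ3 ^ 2 = 0 := by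
        have : sigmaM P1 Q1 = 0 := by rw [← h1Q]; simp [sigmaM, eta]
        linarith
      rw [← h1Q, sigmaD_self, hs2]
      exact iff_of_false (fun h => hpos.ne' h.2) (fun h => (pow_pos hs 2).ne' h.2)
    have hD1Q := sigmaD_of_pos (lam0 := lam0) (htime P1 (by simp) Q1 (by simp) h1Q)
    by_cases h0Q : P0 = Q1
    · have hα : 2 * s + α0 = 0 := by simpa [hP0, hQ1] using (congrFun h0Q 0).symm
      rw [← h0Q, sigmaD_self, sigmaD_comm lam0 P1 P0, hD01]
      refine iff_of_false (fun h => ?_) (fun h => ?_)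
      · linarith [h.1]
      · nlinarith [h.1, sq_nonneg lam0]
    rw [hD1Q, sigmaD_of_pos (htime P0 (by simp) Q1 (by simp) h0Q), hM0Q, hM1Q]
    constructor <;> rintro ⟨h1, h2⟩ <;> constructor <;> linarith
  · have hα : s * (s + α0) = s ^ 2 + 3 * lam0 ^ 2 ↔ α0 = 3 * lam0 ^ 2 / s := by
      rw [eq_div_iff hs.ne']
      constructor <;> intro h <;> linarith
    rw [hα]
    refine and_congr_right fun h => ?_
    have hsq : (s + α0) ^ 2 - s ^ 2 = 6 * lam0 ^ 2 * (1 + 3 * lam0 ^ 2 / (2 * s ^ 2)) := by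
      rw [h]
      field_simp
      ring
    rw [← hsq]
    constructor <;> intro h <;> linarith
end

section
/- The timelike straight-line segment of the distorted space-time is a tube: let λ0 > 0, μ > √2·λ0, and s := √(μ² − 2λ0²). For every t ∈ [0, s] and r ≥ 0 such that t² − r² + 2λ0² ≥ 0 and (s−t)² − r² + 2λ0² ≥ 0, the equation √(t² − r² + 2λ0²) + √((s−t)² − r² + 2λ0²) = μ holds if and only if r² = 2λ0²(t − s/2)²/μ² + (3/2)λ0². (This equation is the defining condition |P0R| + |RP1| = |P0P1| of the segment between P0 = (0,0,0,0) and P1 = (s,0,0,0), for a running point R = (t, x) with r = ‖x‖, where the squared lengths are |P0R|² = t² − r² + 2λ0², |RP1|² = (s−t)² − r² + 2λ0², |P0P1|² = s² + 2λ0² = μ².) -/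
/-- The timelike straight-line segment of the distorted space-time is a
tube: for `lam0 > 0`, `μ > √2·lam0`, `s = √(μ² − 2lam0²)`, `t ∈ [0,s]`, `r ≥ 0` with both
radicands nonnegative, the defining condition `|P0R| + |RP1| = |P0P1|` of the segment,
i.e. `√(t² − r² + 2lam0²) + √((s−t)² − r² + 2lam0²) = μ`, holds iff
`r² = 2lam0²(t − s/2)²/μ² + (3/2)lam0²`. -/
theorem segment_is_tube (lam0 μ t r : ℝ) (hlam0 : 0 < lam0)
    (hμ : Real.sqrt 2 * lam0 < μ)
    (s : ℝ) (hs : s = Real.sqrt (μ ^ 2 - 2 * lam0 ^ 2))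
    (ht : t ∈ Set.Icc 0 s) (hr : 0 ≤ r)
    (h1 : 0 ≤ t ^ 2 - r ^ 2 + 2 * lam0 ^ 2)
    (h2 : 0 ≤ (s - t) ^ 2 - r ^ 2 + 2 * lam0 ^ 2) :
    Real.sqrt (t ^ 2 - r ^ 2 + 2 * lam0 ^ 2)
        + Real.sqrt ((s - t) ^ 2 - r ^ 2 + 2 * lam0 ^ 2) = μ ↔
      r ^ 2 = 2 * lam0 ^ 2 * (t - s / 2) ^ 2 / μ ^ 2 + 3 / 2 * lam0 ^ 2 := by
  have hμ0 : 0 < μ := lt_of_le_of_lt (by positivity) hμ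
  have hsμ : 2 * lam0 ^ 2 < μ ^ 2 := by
    have h := pow_lt_pow_left₀ hμ (by positivity) two_ne_zero
    rwa [mul_pow, Real.sq_sqrt zero_le_two] at h
  have hs2 : s ^ 2 = μ ^ 2 - 2 * lam0 ^ 2 := by
    rw [hs, Real.sq_sqrt (by linarith)]
  obtain ⟨ht0, hts⟩ := ht
  -- `k` is the rescaled displacement from the midpoint; on the segment the two lengths
  -- are `μ / 2 + k * s` and `μ / 2 - k * s`.
  obtain ⟨k, hk⟩ : ∃ k, t = s / 2 + k * μ := ⟨(t - s / 2) / μ, by field_simp; ring⟩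
  have hrhs : 2 * lam0 ^ 2 * (t - s / 2) ^ 2 / μ ^ 2 = 2 * lam0 ^ 2 * k ^ 2 := by
    rw [hk]; field_simp; ring
  rw [hrhs]
  constructor
  · intro h
    have ha := Real.sq_sqrt h1
    have hb := Real.sq_sqrt h2
    set a := Real.sqrt (t ^ 2 - r ^ 2 + 2 * lam0 ^ 2)
    set b := Real.sqrt ((s - t) ^ 2 - r ^ 2 + 2 * lam0 ^ 2)
    have hab : a - b = 2 * k * s := by
      apply mul_right_cancel₀ hμ0.ne'
      calc (a - b) * μ = a ^ 2 - b ^ 2 := by rw [← h]; ring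
        _ = 2 * k * s * μ := by rw [ha, hb, hk]; ring
    have ha' : a = μ / 2 + k * s := by linarith
    rw [ha', hk] at ha
    linear_combination ha - (k ^ 2 - 1 / 4) * hs2
  · intro h
    have hA : t ^ 2 - r ^ 2 + 2 * lam0 ^ 2 = (μ / 2 + k * s) ^ 2 := by
      rw [hk]; linear_combination (-1 : ℝ) * h - (k ^ 2 - 1 / 4) * hs2
    have hB : (s - t) ^ 2 - r ^ 2 + 2 * lam0 ^ 2 = (μ / 2 - k * s) ^ 2 := by
      rw [hk]; linear_combination (-1 : ℝ) * h - (k ^ 2 - 1 / 4) * hs2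
    have hs0 : 0 ≤ s := ht0.trans hts
    have hpos : 0 ≤ μ / 2 + k * s :=
      nonneg_of_mul_nonneg_left (b := μ) (by nlinarith) hμ0
    have hneg : 0 ≤ μ / 2 - k * s :=
      nonneg_of_mul_nonneg_left (b := μ) (by nlinarith) hμ0
    rw [hA, hB, Real.sqrt_sq hpos, Real.sqrt_sq hneg]
    ring
end
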